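/- For every x with -1 < x < 1 and every ε > 0 there exists L = L(x,ε) > 0 such that for all real λ > L and all n ∈ ℕ₀: |C_n^{(λ)}(x)/C_n^{(λ)}(1) - xⁿ| < ε. -/

import Mathlib

open scoped RealInnerProductSpace BigOperators ComplexOrder
open Polynomial MeasureTheory Filter

/-- Gegenbauer polynomial `C_n^{(λ)}(x)` via its explicit formula. -/
noncomputable def gegenbauerC (lam : ℝ) (n : ℕ) (x : ℝ) : ℝ :=
  ∑ k ∈ Finset.range (n / 2 + 1),
    (-1 : ℝ) ^ k * ((ascPochhammer ℝ (n - k)).eval lam /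
      ((Nat.factorial k : ℝ) * (Nat.factorial (n - 2 * k) : ℝ))) * (2 * x) ^ (n - 2 * k)

/-- Chebyshev polynomial of the first kind, evaluated at a real number. -/
noncomputable def chebyshevT (n : ℕ) (x : ℝ) : ℝ := (Polynomial.Chebyshev.T ℝ (n : ℤ)).eval x

/-- Normalized ultraspherical polynomials `c_n(d,x)`: for `d ≥ 2` the Gegenbauer polynomial
with parameter `λ = (d-1)/2` normalized to be `1` at `x = 1`; for `d = 1` the Chebyshev
polynomial `T_n`. -/
noncomputable def ultraC (d n : ℕ) (x : ℝ) : ℝ :=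
  if d = 1 then chebyshevT n x
  else gegenbauerC (((d : ℝ) - 1) / 2) n x / gegenbauerC (((d : ℝ) - 1) / 2) n 1

/-- Dimension `N_n(d)` of the space of spherical harmonics of degree `n` on `S^d`. -/
noncomputable def NNdim (n d : ℕ) : ℝ :=
  if n = 0 then 1
  else (ascPochhammer ℝ (n - 1)).eval (d : ℝ) * (2 * n + d - 1) / Nat.factorial n

/-- Total surface measure `σ_d = 2 π^((d+1)/2) / Γ((d+1)/2)` of the sphere `S^d`
(for `d = 0` this gives the value `2`). -/
noncomputable def sigmaS (d : ℕ) : ℝ :=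
  2 * Real.pi ^ (((d : ℝ) + 1) / 2) / Real.Gamma (((d : ℝ) + 1) / 2)

/-- The class `𝒫(G)` of continuous positive definite functions on a topological group `G`. -/
def IsPosDefOnGroup {G : Type*} [Group G] [TopologicalSpace G] (φ : G → ℂ) : Prop :=
  Continuous φ ∧ ∀ (n : ℕ) (u : Fin n → G) (a : Fin n → ℂ),
    0 ≤ ∑ k, ∑ l, φ ((u k)⁻¹ * u l) * a k * (starRingEnd ℂ) (a l)

/-- The class `𝒫(S^d, G)`: continuous functions `f` on `[-1,1] × G` such that the kernel
`((ξ,u),(η,v)) ↦ f(ξ·η, u⁻¹v)` is positive definite on `(S^d × G)²`, where `S^d` is the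
unit sphere of `ℝ^(d+1)`. -/
def IsPosDefSphereGroup (d : ℕ) {G : Type*} [Group G] [TopologicalSpace G]
    (f : ℝ → G → ℂ) : Prop :=
  ContinuousOn (fun p : ℝ × G => f p.1 p.2) (Set.Icc (-1 : ℝ) 1 ×ˢ Set.univ) ∧
  ∀ (n : ℕ) (ξ : Fin n → EuclideanSpace ℝ (Fin (d + 1))) (u : Fin n → G),
    (∀ k, ‖ξ k‖ = 1) → ∀ a : Fin n → ℂ,
      0 ≤ ∑ k, ∑ l, f ⟪ξ k, ξ l⟫ ((u k)⁻¹ * u l) * a k * (starRingEnd ℂ) (a l)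

/-- The `n`-th `d`-Schoenberg function of `f`:
`φ_{n,d}(u) = (N_n(d) σ_{d-1} / σ_d) ∫_{-1}^1 f(x,u) c_n(d,x) (1-x²)^{d/2-1} dx`. -/
noncomputable def schoenbergFn (d : ℕ) {G : Type*} [Group G] [TopologicalSpace G]
    (f : ℝ → G → ℂ) (n : ℕ) (u : G) : ℂ :=
  ((NNdim n d * sigmaS (d - 1) / sigmaS d : ℝ) : ℂ) *
    ∫ x in (-1 : ℝ)..1, f x u * ((ultraC d n x : ℝ) : ℂ) *
      (((1 - x ^ 2) ^ ((d : ℝ) / 2 - 1) : ℝ) : ℂ)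

/-- The `k`-th term of the explicit formula for `C_n^{(λ)}(x)`, extended by zero. -/
noncomputable def gegenbauerTerm (lam : ℝ) (n : ℕ) (x : ℝ) (k : ℕ) : ℝ :=
  if 2 * k ≤ n then
    (-1 : ℝ) ^ k * ((ascPochhammer ℝ (n - k)).eval lam /
      ((Nat.factorial k : ℝ) * (Nat.factorial (n - 2 * k) : ℝ))) * (2 * x) ^ (n - 2 * k)
  else 0

lemma gegenbauerC_eq_sum_term (lam : ℝ) (n : ℕ) (x : ℝ) {M : ℕ} (hM : n / 2 + 1 ≤ M) :
    gegenbauerC lam n x = ∑ k ∈ Finset.range M, gegenbauerTerm lam n x k := by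
  rw [← Finset.sum_subset (Finset.range_mono hM)]
  · refine Finset.sum_congr rfl fun k hk => ?_
    rw [Finset.mem_range] at hk
    rw [gegenbauerTerm, if_pos (by omega)]
  · intro k _ hk
    rw [Finset.mem_range] at hk
    rw [gegenbauerTerm, if_neg (by omega)]

lemma gegenbauerTerm_two_mul_add (lam : ℝ) (j k : ℕ) (x : ℝ) :
    gegenbauerTerm lam (2 * k + j) x k =
      (-1 : ℝ) ^ k * ((ascPochhammer ℝ (k + j)).eval lam /
        ((Nat.factorial k : ℝ) * (Nat.factorial j : ℝ))) * (2 * x) ^ j := by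
  rw [gegenbauerTerm, if_pos (by omega), show 2 * k + j - k = k + j by omega,
    show 2 * k + j - 2 * k = j by omega]

lemma gegenbauerTerm_zero_recurrence (lam : ℝ) (n : ℕ) (x : ℝ) :
    ((n : ℝ) + 2) * gegenbauerTerm lam (n + 2) x 0 =
      2 * x * (n + 1 + lam) * gegenbauerTerm lam (n + 1) x 0 := by
  have h1 := gegenbauerTerm_two_mul_add lam (n + 2) 0 x
  have h2 := gegenbauerTerm_two_mul_add lam (n + 1) 0 x
  simp only [mul_zero, zero_add] at h1 h2
  rw [h1, h2, ascPochhammer_succ_eval (n + 1), Nat.factorial_succ (n + 1)]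
  have := Nat.cast_ne_zero (R := ℝ).2 (Nat.factorial_ne_zero (n + 1))
  push_cast
  field_simp
  ring

lemma gegenbauerTerm_succ_recurrence (lam : ℝ) (n : ℕ) (x : ℝ) (k : ℕ) :
    ((n : ℝ) + 2) * gegenbauerTerm lam (n + 2) x (k + 1) =
      2 * x * (n + 1 + lam) * gegenbauerTerm lam (n + 1) x (k + 1) -
        (n + 2 * lam) * gegenbauerTerm lam n x k := by
  rcases lt_or_ge n (2 * k) with h | h
  · simp only [gegenbauerTerm]
    rw [if_neg (by omega), if_neg (by omega), if_neg (by omega)]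
    ring
  obtain ⟨j, rfl⟩ := Nat.exists_eq_add_of_le h
  have hk := Nat.cast_ne_zero (R := ℝ).2 (Nat.factorial_ne_zero k)
  have h1 := gegenbauerTerm_two_mul_add lam j (k + 1) x
  rw [show 2 * (k + 1) + j = 2 * k + j + 2 by ring] at h1
  rw [h1, gegenbauerTerm_two_mul_add]
  cases j with
  | zero =>
    have h2 : gegenbauerTerm lam (2 * k + 0 + 1) x (k + 1) = 0 := by
      rw [gegenbauerTerm, if_neg (by omega)]
    rw [h2, add_zero, add_zero, ascPochhammer_succ_eval, Nat.factorial_succ k]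
    push_cast
    field_simp
    ring_nf
  | succ i =>
    have h2 := gegenbauerTerm_two_mul_add lam i (k + 1) x
    rw [show 2 * (k + 1) + i = 2 * k + (i + 1) + 1 by ring] at h2
    have hi := Nat.cast_ne_zero (R := ℝ).2 (Nat.factorial_ne_zero i)
    rw [h2, show k + 1 + (i + 1) = k + i + 1 + 1 by ring, show k + 1 + i = k + i + 1 by ring,
      show k + (i + 1) = k + i + 1 by ring, ascPochhammer_succ_eval (k + i + 1),
      Nat.factorial_succ k, Nat.factorial_succ i]
    push_cast
    field_simp
    ring

/-- The three-term recurrence of the Gegenbauer polynomials. -/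
lemma gegenbauerC_recurrence (lam : ℝ) (n : ℕ) (x : ℝ) :
    ((n : ℝ) + 2) * gegenbauerC lam (n + 2) x =
      2 * x * (n + 1 + lam) * gegenbauerC lam (n + 1) x -
        (n + 2 * lam) * gegenbauerC lam n x := by
  rw [gegenbauerC_eq_sum_term lam (n + 2) x (M := n + 2 + 1) (by omega),
    gegenbauerC_eq_sum_term lam (n + 1) x (M := n + 2 + 1) (by omega),
    gegenbauerC_eq_sum_term lam n x (M := n + 2) (by omega),
    Finset.sum_range_succ' _ (n + 2), Finset.sum_range_succ' _ (n + 2), mul_add, mul_add,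
    gegenbauerTerm_zero_recurrence, Finset.mul_sum, Finset.mul_sum, Finset.mul_sum,
    Finset.sum_congr rfl fun k _ => gegenbauerTerm_succ_recurrence lam n x k,
    Finset.sum_sub_distrib]
  ring

lemma gegenbauerC_zero (lam x : ℝ) : gegenbauerC lam 0 x = 1 := by
  simp [gegenbauerC]

lemma gegenbauerC_one (lam x : ℝ) : gegenbauerC lam 1 x = 2 * lam * x := by
  simp [gegenbauerC]
  ring

lemma succ_mul_gegenbauerC_succ_at_one (lam : ℝ) (n : ℕ) :
    ((n : ℝ) + 1) * gegenbauerC lam (n + 1) 1 = (n + 2 * lam) * gegenbauerC lam n 1 := by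
  induction n with
  | zero => simp [gegenbauerC_zero, gegenbauerC_one]
  | succ n ih =>
    have h := gegenbauerC_recurrence lam n 1
    push_cast
    linear_combination h + ih

lemma gegenbauerC_at_one_pos {lam : ℝ} (hlam : 0 < lam) (n : ℕ) : 0 < gegenbauerC lam n 1 := by
  induction n with
  | zero => simp [gegenbauerC_zero]
  | succ n ih =>
    have h := succ_mul_gegenbauerC_succ_at_one lam n
    have h' : 0 < ((n : ℝ) + 1) * gegenbauerC lam (n + 1) 1 := by rw [h]; positivity
    exact pos_of_mul_pos_right h' (by positivity)

/-- The Gegenbauer polynomial normalized to take the value `1` at `1`. -/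
noncomputable def normalizedGegenbauer (lam : ℝ) (n : ℕ) (x : ℝ) : ℝ :=
  gegenbauerC lam n x / gegenbauerC lam n 1

lemma normalizedGegenbauer_zero (lam x : ℝ) : normalizedGegenbauer lam 0 x = 1 := by
  simp [normalizedGegenbauer, gegenbauerC_zero]

lemma normalizedGegenbauer_one {lam : ℝ} (hlam : 0 < lam) (x : ℝ) :
    normalizedGegenbauer lam 1 x = x := by
  rw [normalizedGegenbauer, gegenbauerC_one, gegenbauerC_one]
  field_simp

lemma normalizedGegenbauer_recurrence {lam : ℝ} (hlam : 0 < lam) (n : ℕ) (x : ℝ) :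
    normalizedGegenbauer lam (n + 2) x = x * normalizedGegenbauer lam (n + 1) x +
      ((n : ℝ) + 1) / (2 * lam + (n + 1)) *
        (x * normalizedGegenbauer lam (n + 1) x - normalizedGegenbauer lam n x) := by
  have h0 := gegenbauerC_at_one_pos hlam n
  have hs1 := succ_mul_gegenbauerC_succ_at_one lam n
  have hs2 := succ_mul_gegenbauerC_succ_at_one lam (n + 1)
  push_cast at hs2
  have e1 : gegenbauerC lam (n + 1) 1 = (n + 2 * lam) * gegenbauerC lam n 1 / (n + 1) := by
    rw [eq_div_iff (by positivity), ← hs1]; ring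
  have e2 : gegenbauerC lam (n + 2) 1 =
      (n + 1 + 2 * lam) * ((n + 2 * lam) * gegenbauerC lam n 1 / (n + 1)) / (n + 2) := by
    rw [eq_div_iff (by positivity), ← e1, ← hs2]; ring
  have e3 : gegenbauerC lam (n + 2) x = (2 * x * (n + 1 + lam) * gegenbauerC lam (n + 1) x -
        (n + 2 * lam) * gegenbauerC lam n x) / (n + 2) := by
    rw [eq_div_iff (by positivity), ← gegenbauerC_recurrence]; ring
  rw [normalizedGegenbauer, normalizedGegenbauer, normalizedGegenbauer, e2, e1, e3]
  have : (n : ℝ) + 2 * lam ≠ 0 := by positivity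
  have : (n : ℝ) + 1 + 2 * lam ≠ 0 := by positivity
  have : 2 * lam + ((n : ℝ) + 1) ≠ 0 := by positivity
  field_simp
  ring

lemma tendsto_normalizedGegenbauer (n : ℕ) (x : ℝ) :
    Tendsto (fun lam => normalizedGegenbauer lam n x) atTop (nhds (x ^ n)) := by
  induction n using Nat.twoStepInduction with
  | zero => simp [normalizedGegenbauer_zero]
  | one =>
    rw [pow_one]
    refine tendsto_const_nhds.congr' ?_
    filter_upwards [eventually_gt_atTop 0] with lam hlam
    exact (normalizedGegenbauer_one hlam x).symm
  | more n ih0 ih1 =>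
    have ht : Tendsto (fun lam : ℝ => ((n : ℝ) + 1) / (2 * lam + (n + 1))) atTop (nhds 0) :=
      tendsto_const_nhds.div_atTop
        (tendsto_atTop_add_const_right _ _ (tendsto_id.const_mul_atTop two_pos))
    have h := (ih1.const_mul x).add (ht.mul ((ih1.const_mul x).sub ih0))
    rw [zero_mul, add_zero, ← pow_succ'] at h
    refine h.congr' ?_
    filter_upwards [eventually_gt_atTop 0] with lam hlam
    exact (normalizedGegenbauer_recurrence hlam n x).symm

/-- A quadratic form in two consecutive normalized Gegenbauer polynomials which is
nonincreasing in the degree. -/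
noncomputable def gegenbauerEnergy (lam x : ℝ) (n : ℕ) : ℝ :=
  (1 - x ^ 2) * normalizedGegenbauer lam (n + 1) x ^ 2 +
    (x * normalizedGegenbauer lam (n + 1) x - normalizedGegenbauer lam n x) ^ 2

lemma gegenbauerEnergy_antitone {lam : ℝ} (hlam : 0 < lam) (x : ℝ) :
    Antitone (gegenbauerEnergy lam x) := by
  refine antitone_nat_of_succ_le fun n => ?_
  rw [gegenbauerEnergy, gegenbauerEnergy, normalizedGegenbauer_recurrence hlam]
  set t : ℝ := ((n : ℝ) + 1) / (2 * lam + (n + 1))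
  have ht0 : 0 ≤ t := by positivity
  have ht1 : t ≤ 1 := div_le_one_of_le₀ (by linarith) (by positivity)
  have ht2 : t ^ 2 ≤ 1 := pow_le_one₀ ht0 ht1
  set c := normalizedGegenbauer lam (n + 1) x
  set s := x * c - normalizedGegenbauer lam n x
  have := mul_le_mul_of_nonneg_right ht2 (sq_nonneg s)
  linear_combination this

lemma tendsto_gegenbauerEnergy (n : ℕ) (x : ℝ) :
    Tendsto (fun lam => gegenbauerEnergy lam x n) atTop (nhds ((1 - x ^ 2) * (x ^ n) ^ 2)) := by
  have h0 := tendsto_normalizedGegenbauer n x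
  have h1 := tendsto_normalizedGegenbauer (n + 1) x
  have h := ((h1.pow 2).const_mul (1 - x ^ 2)).add (((h1.const_mul x).sub h0).pow 2)
  rw [show (1 - x ^ 2) * (x ^ n) ^ 2 =
    (1 - x ^ 2) * (x ^ (n + 1)) ^ 2 + (x * x ^ (n + 1) - x ^ n) ^ 2 by ring]
  exact h

/-- Lemma 1 of Schoenberg (1942): for fixed `x ∈ (-1,1)` and `ε > 0` there is `L > 0` such
that the normalized Gegenbauer polynomials satisfy `|C_n^{(λ)}(x)/C_n^{(λ)}(1) - xⁿ| < ε`
for all `n`, provided `λ > L`. -/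
theorem normalized_gegenbauer_tendsto_pow (x : ℝ) (hx : x ∈ Set.Ioo (-1 : ℝ) 1)
    (ε : ℝ) (hε : 0 < ε) :
    ∃ L : ℝ, 0 < L ∧ ∀ lam : ℝ, L < lam → ∀ n : ℕ,
      |gegenbauerC lam n x / gegenbauerC lam n 1 - x ^ n| < ε := by
  obtain ⟨hx0, hx1⟩ := hx
  have habs : |x| < 1 := abs_lt.2 ⟨hx0, hx1⟩
  have hw : 0 < 1 - x ^ 2 := by nlinarith
  have hδ : 0 < ε / 2 := by positivity
  obtain ⟨N, hN⟩ := exists_pow_lt_of_lt_one hδ habs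
  have hN2 : (x ^ N) ^ 2 < (ε / 2) ^ 2 := by
    rw [← sq_abs, abs_pow]
    exact pow_lt_pow_left₀ hN (by positivity) two_ne_zero
  have hE := (tendsto_gegenbauerEnergy N x).eventually_lt_const
    (mul_lt_mul_of_pos_left hN2 hw)
  have hsmall : ∀ᶠ lam in atTop, ∀ n ∈ Finset.range (N + 1),
      |normalizedGegenbauer lam n x - x ^ n| < ε :=
    (Finset.eventually_all _).2 fun n _ => by
      simpa [Real.dist_eq] using Metric.tendsto_nhds.1 (tendsto_normalizedGegenbauer n x) ε hε
  obtain ⟨L, hL⟩ := eventually_atTop.1 (hE.and hsmall)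
  refine ⟨max L 1, by positivity, fun lam hlam n => ?_⟩
  obtain ⟨hLlam, hlam1⟩ := max_lt_iff.1 hlam
  have hlam0 : 0 < lam := one_pos.trans hlam1
  obtain ⟨hEl, hsl⟩ := hL lam hLlam.le
  rcases lt_or_ge n (N + 1) with hn | hn
  · exact hsl n (Finset.mem_range.2 hn)
  obtain ⟨m, rfl⟩ := Nat.exists_eq_add_of_le' (show 1 ≤ n by omega)
  have hmono := gegenbauerEnergy_antitone hlam0 x (show N ≤ m by omega)
  have hsq : normalizedGegenbauer lam (m + 1) x ^ 2 < (ε / 2) ^ 2 := by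
    refine lt_of_mul_lt_mul_left ((le_add_of_nonneg_right (sq_nonneg _)).trans_lt
      (hmono.trans_lt hEl)) hw.le
  have hc : |normalizedGegenbauer lam (m + 1) x| < ε / 2 := abs_lt_of_sq_lt_sq hsq hδ.le
  have hp : |x ^ (m + 1)| < ε / 2 := by
    rw [abs_pow]
    exact (pow_le_pow_of_le_one (abs_nonneg x) habs.le (by omega)).trans_lt hN
  calc |normalizedGegenbauer lam (m + 1) x - x ^ (m + 1)|
      ≤ |normalizedGegenbauer lam (m + 1) x| + |x ^ (m + 1)| := abs_sub _ _
    _ < ε := by linarith
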